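/- arXiv:math/0403168 — 2 statements merged into one kernel-verified Lean document; each statement's English description precedes it below -/
import Mathlib

section
/- Define polynomials TO_n(x,q) by TO₀ = 1, TO₁ = 1 + xq, and TO_n = (2 + x qⁿ)·TO_{n−1} − TO_{n−2} for n ≥ 2. Then for every n ≥ 1, x qⁿ · TO_{n−1}(x,q) = ∑_{m=1}^{n} x^m q^{n + m(m−1)/2} ∑_{j=0}^{n−m} [m+j−1 choose m−1]_q · [n−j−2 choose m−2]_q, an equality of polynomials in ℚ[x,q]. -/
/-!
Statement 4: Define polynomials `TO_n(x,q)` by `TO₀ = 1`, `TO₁ = 1 + xq`, and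
`TO_n = (2 + x qⁿ)·TO_{n−1} − TO_{n−2}` for `n ≥ 2`.  Then for every `n ≥ 1`,
`x qⁿ·TO_{n−1}(x,q) = ∑_{m=1}^{n} x^m q^{n + m(m−1)/2} ∑_{j=0}^{n−m}
  [m+j−1 choose m−1]_q · [n−j−2 choose m−2]_q`,
an equality of polynomials in `ℚ[x,q]`.

`TO_n` is defined in `MvPolynomial (Fin 2) ℚ` with `x = X 0`, `q = X 1`.  Since the
Gaussian binomials are encoded as quotients `∏(1 − q^{a−b+i})·(∏(1 − qⁱ))⁻¹`, the
identity is stated in `ℚ[[x,q]]` (after the canonical injective coercion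
`ℚ[x,q] → ℚ[[x,q]]`), which is equivalent to the polynomial identity.  The Gaussian
binomial `[a choose b]_q` is defined for `b ≥ 0` as
`∏_{i=1}^{b} (1 − q^{a−b+i})/(1 − qⁱ)` (equal to `0` when `0 ≤ a < b`), and by
convention `[a choose −1]_q = 1` if `a = −1` and `0` otherwise.
-/

noncomputable section

abbrev S2 : Type := MvPowerSeries (Fin 2) ℚ

/-- The Gaussian binomial coefficient `[a choose b]_q` as an element of `ℚ[[x,q]]`:
for `b ≥ 0` it is `∏_{i=1}^{b} (1 − q^{a−b+i}) / ∏_{i=1}^{b} (1 − qⁱ)`;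
`[a choose −1]_q = 1` if `a = −1` and `0` otherwise. -/
def gaussZ (a b : ℤ) : S2 :=
  if b < 0 then (if b = -1 ∧ a = -1 then 1 else 0)
  else (∏ i ∈ Finset.Icc 1 b.toNat, (1 - (MvPowerSeries.X 1 : S2) ^ (a - b + i).toNat)) *
    Ring.inverse (∏ i ∈ Finset.Icc 1 b.toNat, (1 - (MvPowerSeries.X 1 : S2) ^ i))

open MvPolynomial in
/-- The stack polynomials `TO_n(x,q)`: `TO₀ = 1`, `TO₁ = 1 + xq`,
`TO_{n+2} = (2 + x q^{n+2})·TO_{n+1} − TO_n`. -/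
def TO : ℕ → MvPolynomial (Fin 2) ℚ
  | 0 => 1
  | 1 => 1 + X 0 * X 1
  | (n + 2) => (2 + X 0 * (X 1) ^ (n + 2)) * TO (n + 1) - TO n

/-- The generating series `∑ⱼ [k-1+j choose k-1]_q zʲ`, which equals `1 / (z; q)_k`. -/
def gaussSeries (k : ℕ) : PowerSeries S2 :=
  PowerSeries.mk fun j ↦ gaussZ ((k : ℤ) + j - 1) ((k : ℤ) - 1)

lemma gaussZ_neg_one (j : ℕ) : gaussZ (((0 : ℕ) : ℤ) + j - 1) (((0 : ℕ) : ℤ) - 1) =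
    if j = 0 then 1 else 0 := by
  unfold gaussZ
  rw [if_pos (by simp)]
  congr 1
  simp

lemma gaussZ_succ (k j : ℕ) : gaussZ (((k + 1 : ℕ) : ℤ) + j - 1) (((k + 1 : ℕ) : ℤ) - 1) =
    (∏ i ∈ Finset.range k, (1 - (MvPowerSeries.X 1 : S2) ^ (j + i + 1))) *
      Ring.inverse (∏ i ∈ Finset.range k, (1 - (MvPowerSeries.X 1 : S2) ^ (i + 1))) := by
  have shift (f : ℕ → S2) : ∏ i ∈ Finset.Icc 1 k, f i = ∏ i ∈ Finset.range k, f (i + 1) := by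
    rw [Finset.range_eq_Ico, Finset.prod_Ico_add' f 0 k 1]
    rfl
  unfold gaussZ
  rw [if_neg (by simp)]
  have hk : (((k + 1 : ℕ) : ℤ) - 1).toNat = k := by simp
  rw [hk, shift, shift]
  congr 1
  refine Finset.prod_congr rfl fun i _ ↦ ?_
  congr 2
  push_cast
  omega

lemma isUnit_one_sub_q_pow (i : ℕ) : IsUnit (1 - (MvPowerSeries.X 1 : S2) ^ (i + 1)) := by
  rw [MvPowerSeries.isUnit_iff_constantCoeff]
  simp

lemma gaussZ_pascal (k j : ℕ) :
    gaussZ (((k + 1 : ℕ) : ℤ) + (j + 1 : ℕ) - 1) (((k + 1 : ℕ) : ℤ) - 1) =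
      gaussZ (((k + 1 : ℕ) : ℤ) + j - 1) (((k + 1 : ℕ) : ℤ) - 1) +
        (MvPowerSeries.X 1) ^ (j + 1) * gaussZ ((k : ℤ) + (j + 1 : ℕ) - 1) ((k : ℤ) - 1) := by
  cases k with
  | zero => rw [gaussZ_succ, gaussZ_succ, gaussZ_neg_one]; simp
  | succ k =>
    rw [gaussZ_succ, gaussZ_succ, gaussZ_succ]
    rw [Finset.prod_range_succ, Finset.prod_range_succ' (fun i ↦ 1 - _ ^ (j + i + 1)),
      Finset.prod_range_succ (fun i ↦ 1 - _ ^ (i + 1)), Ring.mul_inverse_rev]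
    have hu := Ring.inverse_mul_cancel _ (isUnit_one_sub_q_pow k)
    have hp : ∏ i ∈ Finset.range k, (1 - (MvPowerSeries.X 1 : S2) ^ (j + (i + 1) + 1)) =
        ∏ i ∈ Finset.range k, (1 - (MvPowerSeries.X 1 : S2) ^ (j + 1 + i + 1)) :=
      Finset.prod_congr rfl fun i _ ↦ by ring_nf
    rw [hp]
    linear_combination ((MvPowerSeries.X 1 : S2) ^ (j + 1) *
      (∏ i ∈ Finset.range k, (1 - (MvPowerSeries.X 1 : S2) ^ (j + 1 + i + 1))) *
      Ring.inverse (∏ i ∈ Finset.range k, (1 - (MvPowerSeries.X 1 : S2) ^ (i + 1)))) * hu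

lemma gaussZ_self (k : ℕ) : gaussZ ((k : ℤ) + (0 : ℕ) - 1) ((k : ℤ) - 1) = 1 := by
  cases k with
  | zero => rw [gaussZ_neg_one]; simp
  | succ k =>
    rw [gaussZ_succ]
    simp only [zero_add]
    refine Ring.mul_inverse_cancel _ ?_
    rw [IsUnit.prod_iff]
    exact fun i _ ↦ isUnit_one_sub_q_pow i

lemma gaussSeries_zero : gaussSeries 0 = 1 := by
  ext1 j
  rw [gaussSeries, PowerSeries.coeff_mk, gaussZ_neg_one, PowerSeries.coeff_one]

lemma one_sub_X_mul_gaussSeries (k : ℕ) :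
    (1 - PowerSeries.X) * gaussSeries (k + 1) =
      PowerSeries.rescale (MvPowerSeries.X 1) (gaussSeries k) := by
  ext1 j
  rw [PowerSeries.coeff_rescale, sub_mul, one_mul, map_sub]
  cases j with
  | zero =>
    rw [PowerSeries.coeff_zero_X_mul]
    simp only [gaussSeries, PowerSeries.coeff_mk, gaussZ_self]
    simp
  | succ j =>
    rw [PowerSeries.coeff_succ_X_mul]
    simp only [gaussSeries, PowerSeries.coeff_mk]
    rw [gaussZ_pascal]
    ring

/-- The contribution of degree `k` in `x` to the generating series `∑ₙ TOₙ zⁿ`. -/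
def stackSeries (k : ℕ) : PowerSeries S2 :=
  PowerSeries.C ((MvPowerSeries.X 0 : S2) ^ k * (MvPowerSeries.X 1) ^ ((k + 1) * k / 2)) *
    (PowerSeries.X ^ k * (gaussSeries (k + 1) * gaussSeries k))

lemma coeff_stackSeries_zero (n : ℕ) : PowerSeries.coeff n (stackSeries 0) = 1 := by
  rw [stackSeries, gaussSeries_zero]
  simpa [gaussSeries] using gaussZ_succ 0 n

lemma coeff_stackSeries_of_lt {n k : ℕ} (h : n < k) :
    PowerSeries.coeff n (stackSeries k) = 0 := by
  rw [stackSeries, PowerSeries.coeff_C_mul, PowerSeries.coeff_X_pow_mul', if_neg (by omega),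
    mul_zero]

lemma one_sub_X_sq_mul_stackSeries (k : ℕ) :
    (1 - PowerSeries.X) ^ 2 * stackSeries (k + 1) =
      PowerSeries.X * (PowerSeries.C ((MvPowerSeries.X 0 : S2) * MvPowerSeries.X 1) *
        PowerSeries.rescale (MvPowerSeries.X 1) (stackSeries k)) := by
  have hC (a b : S2) : PowerSeries.rescale b (PowerSeries.C a) = PowerSeries.C a := by
    ext1 n
    rw [PowerSeries.coeff_rescale, PowerSeries.coeff_C]
    split_ifs with h <;> simp [h]
  have htri : (k + 1 + 1) * (k + 1) / 2 = (k + 1) * k / 2 + (k + 1) := by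
    rw [show (k + 1 + 1) * (k + 1) = (k + 1) * k + (k + 1) * 2 by ring,
      Nat.add_mul_div_right _ _ two_pos]
  simp only [stackSeries, map_mul, map_pow, hC, PowerSeries.rescale_X,
    ← one_sub_X_mul_gaussSeries, htri]
  ring

lemma coeff_stackSeries_succ (n k : ℕ) :
    PowerSeries.coeff (n + 2) (stackSeries (k + 1)) =
      2 * PowerSeries.coeff (n + 1) (stackSeries (k + 1)) -
        PowerSeries.coeff n (stackSeries (k + 1)) +
        MvPowerSeries.X 0 * MvPowerSeries.X 1 ^ (n + 2) *
          PowerSeries.coeff (n + 1) (stackSeries k) := by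
  have h := congrArg (PowerSeries.coeff (n + 2)) (one_sub_X_sq_mul_stackSeries k)
  rw [show (1 - PowerSeries.X) ^ 2 * stackSeries (k + 1) = stackSeries (k + 1) -
      PowerSeries.X * (2 • stackSeries (k + 1)) +
      PowerSeries.X * (PowerSeries.X * stackSeries (k + 1)) by
        simp only [nsmul_eq_mul]; push_cast; ring,
    map_add, map_sub, PowerSeries.coeff_succ_X_mul, PowerSeries.coeff_succ_X_mul,
    PowerSeries.coeff_succ_X_mul, PowerSeries.coeff_succ_X_mul, PowerSeries.coeff_C_mul,
    PowerSeries.coeff_rescale, map_nsmul, nsmul_eq_mul] at h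
  push_cast at h
  linear_combination h

lemma coeff_stackSeries_one_one :
    PowerSeries.coeff 1 (stackSeries 1) = MvPowerSeries.X 0 * MvPowerSeries.X 1 := by
  have h := congrArg (PowerSeries.coeff 1) (one_sub_X_sq_mul_stackSeries 0)
  rw [show (1 - PowerSeries.X) ^ 2 * stackSeries (0 + 1) = stackSeries 1 -
      PowerSeries.X * (2 • stackSeries 1 - PowerSeries.X * stackSeries 1) by
        simp only [nsmul_eq_mul]; push_cast; ring,
    map_sub, PowerSeries.coeff_succ_X_mul, PowerSeries.coeff_succ_X_mul, PowerSeries.coeff_C_mul,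
    PowerSeries.coeff_rescale, map_sub, map_nsmul, PowerSeries.coeff_zero_X_mul,
    coeff_stackSeries_of_lt zero_lt_one, coeff_stackSeries_zero] at h
  simpa using h

lemma coe_TO_eq_sum (n : ℕ) :
    (TO n : S2) = ∑ k ∈ Finset.range (n + 1), PowerSeries.coeff n (stackSeries k) := by
  induction n using Nat.twoStepInduction with
  | zero => simp [TO, coeff_stackSeries_zero, -PowerSeries.coeff_zero_eq_constantCoeff]
  | one =>
    simp [TO, Finset.sum_range_succ, coeff_stackSeries_zero, coeff_stackSeries_one_one]
  | more n ih ih' =>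
    have h1 := Finset.sum_range_succ' (fun k ↦ PowerSeries.coeff (n + 1) (stackSeries k)) (n + 2)
    have h0 := Finset.sum_range_succ' (fun k ↦ PowerSeries.coeff n (stackSeries k)) (n + 2)
    rw [Finset.sum_range_succ, coeff_stackSeries_of_lt (by omega), add_zero] at h1
    rw [Finset.sum_range_succ, coeff_stackSeries_of_lt (by omega), add_zero,
      Finset.sum_range_succ, coeff_stackSeries_of_lt (by omega), add_zero] at h0
    rw [Finset.sum_range_succ', coeff_stackSeries_zero]
    simp only [coeff_stackSeries_zero] at h0 h1
    simp only [coeff_stackSeries_succ, Finset.sum_add_distrib, Finset.sum_sub_distrib,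
      ← Finset.mul_sum]
    have hT : (TO (n + 2) : S2) = (2 + MvPowerSeries.X 0 * MvPowerSeries.X 1 ^ (n + 2)) *
        (TO (n + 1) : S2) - (TO n : S2) := by
      simp only [← MvPolynomial.coeToMvPowerSeries.ringHom_apply, TO, map_sub, map_mul, map_add,
        map_pow, map_ofNat]
      simp
    rw [hT, ih, ih']
    linear_combination 2 * h1 - h0

lemma coeff_stackSeries {n k : ℕ} (h : k ≤ n) :
    PowerSeries.coeff n (stackSeries k) =
      (MvPowerSeries.X 0 : S2) ^ k * (MvPowerSeries.X 1) ^ ((k + 1) * k / 2) *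
        ∑ j ∈ Finset.range (n - k + 1),
          gaussZ (((k + 1 : ℕ) : ℤ) + j - 1) (((k + 1 : ℕ) : ℤ) - 1) *
            gaussZ (((n + 1 : ℕ) : ℤ) - j - 2) (((k + 1 : ℕ) : ℤ) - 2) := by
  rw [stackSeries, PowerSeries.coeff_C_mul, PowerSeries.coeff_X_pow_mul', if_pos h,
    PowerSeries.coeff_mul, Finset.Nat.sum_antidiagonal_eq_sum_range_succ_mk]
  congr 1
  refine Finset.sum_congr rfl fun j hj ↦ ?_
  rw [Finset.mem_range] at hj
  simp only [gaussSeries, PowerSeries.coeff_mk]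
  congr 2 <;> omega

open MvPolynomial in
theorem stack_polynomial_formula (n : ℕ) (hn : 1 ≤ n) :
    ((X 0 * (X 1) ^ n * TO (n - 1) : MvPolynomial (Fin 2) ℚ) : S2) =
      ∑ m ∈ Finset.Icc 1 n,
        (MvPowerSeries.X 0 : S2) ^ m * (MvPowerSeries.X 1) ^ (n + m * (m - 1) / 2) *
          ∑ j ∈ Finset.range (n - m + 1),
            gaussZ ((m : ℤ) + j - 1) ((m : ℤ) - 1) * gaussZ ((n : ℤ) - j - 2) ((m : ℤ) - 2) := by
  obtain ⟨n, rfl⟩ := Nat.exists_eq_add_of_le' hn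
  have shift (f : ℕ → S2) :
      ∑ m ∈ Finset.Icc 1 (n + 1), f m = ∑ k ∈ Finset.range (n + 1), f (k + 1) := by
    rw [Finset.range_eq_Ico, Finset.sum_Ico_add' f 0 (n + 1) 1]
    rfl
  rw [shift, Nat.add_sub_cancel, MvPolynomial.coe_mul, coe_TO_eq_sum, Finset.mul_sum]
  refine Finset.sum_congr rfl fun k hk ↦ ?_
  rw [coeff_stackSeries (by simpa [Nat.lt_succ_iff] using hk)]
  simp only [Nat.add_sub_add_right, Nat.add_sub_cancel, coe_mul, coe_pow, coe_X]
  ring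

end
end

section
/- Let D₆ = ⟨ρ, τ | ρ⁶ = 1, τ² = 1, τρτ = ρ⁻¹⟩ be the dihedral group of order 12, acting on a finite set X. Then the number of elements of X whose stabilizer is trivial equals |X| + fix(ρ) − fix(ρ²) − fix(ρ³) − 3·fix(τ) − 3·fix(τρ³) + 6·|Fix(⟨ρ³, τ⟩)| + 3·|Fix(⟨ρ², τ⟩)| + 3·|Fix(⟨ρ², τρ³⟩)| − 6·|Fix(D₆)|, where fix(g) = |{x ∈ X : g·x = x}| and, for a subgroup H ≤ D₆, Fix(H) = {x ∈ X : h·x = x for all h ∈ H}. -/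
/-!
Statement 11: Let `D₆ = ⟨ρ, τ | ρ⁶ = 1, τ² = 1, τρτ = ρ⁻¹⟩` act on a finite set `X`.
Then the number of elements of `X` with trivial stabilizer equals
`|X| + fix(ρ) − fix(ρ²) − fix(ρ³) − 3·fix(τ) − 3·fix(τρ³)
  + 6·|Fix(⟨ρ³, τ⟩)| + 3·|Fix(⟨ρ², τ⟩)| + 3·|Fix(⟨ρ², τρ³⟩)| − 6·|Fix(D₆)|`,
where `fix(g) = |{x : g·x = x}|` and `Fix(H) = {x : ∀ h ∈ H, h·x = x}`.

We use Mathlib's `DihedralGroup 6`, with `ρ = r 1` and `τ = sr 0` (so `τρ^k = sr k`,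
in particular `τρ³ = sr 3`).  The subgroups `⟨ρ³, τ⟩`, `⟨ρ², τ⟩`, `⟨ρ², τρ³⟩` are
`Subgroup.closure` of the corresponding pairs, and `Fix(D₆)` consists of the points
fixed by every element of the group.  The identity is stated in `ℤ`.
-/

open DihedralGroup

open scoped Classical in
/-- The indicator of `S = ⊥` is the sum of `μ(⊥, H)` over the subgroups `H ≤ S`, where `μ` is the
Möbius function of the subgroup lattice of `DihedralGroup 6`. -/
theorem DihedralGroup.ite_eq_bot_eq_moebius_sum (S : Subgroup (DihedralGroup 6)) :
    (if S = ⊥ then 1 else 0 : ℤ) =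
      1 + (if r 1 ∈ S then 1 else 0) - (if r 2 ∈ S then 1 else 0) - (if r 3 ∈ S then 1 else 0)
        - ((if sr 0 ∈ S then 1 else 0) + (if sr 2 ∈ S then 1 else 0)
          + (if sr 4 ∈ S then 1 else 0))
        - ((if sr 3 ∈ S then 1 else 0) + (if sr 5 ∈ S then 1 else 0)
          + (if sr 1 ∈ S then 1 else 0))
        + 2 * ((if r 3 ∈ S ∧ sr 0 ∈ S then 1 else 0) + (if r 3 ∈ S ∧ sr 2 ∈ S then 1 else 0)
          + (if r 3 ∈ S ∧ sr 4 ∈ S then 1 else 0))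
        + 3 * (if r 2 ∈ S ∧ sr 0 ∈ S then 1 else 0) + 3 * (if r 2 ∈ S ∧ sr 3 ∈ S then 1 else 0)
        - 6 * (if S = ⊤ then 1 else 0) := by
  have mul {a b : DihedralGroup 6} (c : DihedralGroup 6) (ha : a ∈ S) (hb : b ∈ S)
      (h : a * b = c := by decide) : c ∈ S := h ▸ S.mul_mem ha hb
  have r_one : r 1 ∈ S ↔ r 2 ∈ S ∧ r 3 ∈ S :=
    ⟨fun h => ⟨mul (r 2) h h, mul (r 3) h (mul (r 2) h h)⟩,
      fun h => mul (r 1) (mul (r 4) h.1 h.1) h.2⟩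
  have r_two (i : ZMod 6) (h : r 2 ∈ S) (hi : sr i ∈ S) : sr (i + 2) ∈ S := by
    simpa using S.mul_mem hi h
  have r_three (i : ZMod 6) (h : r 3 ∈ S) (hi : sr i ∈ S) : sr (i + 3) ∈ S := by
    simpa using S.mul_mem hi h
  have sr_sr (i j : ZMod 6) (hi : sr i ∈ S) (hj : sr j ∈ S) : r (j - i) ∈ S := by
    simpa using S.mul_mem hi hj
  have r_four : r 4 ∈ S ↔ r 2 ∈ S := ⟨fun h => mul (r 2) h h, fun h => mul (r 4) h h⟩
  have r_five : r 5 ∈ S ↔ r 1 ∈ S := ⟨fun h => S.inv_mem h, fun h => S.inv_mem h⟩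
  have forall_mem (P : DihedralGroup 6 → Prop) : (∀ g, P g) ↔
      (P (r 0) ∧ P (r 1) ∧ P (r 2) ∧ P (r 3) ∧ P (r 4) ∧ P (r 5)) ∧
        P (sr 0) ∧ P (sr 1) ∧ P (sr 2) ∧ P (sr 3) ∧ P (sr 4) ∧ P (sr 5) := by
    constructor
    · intro h
      simp only [h, and_self]
    · rintro ⟨hr, hs⟩ (i | i) <;> fin_cases i <;> tauto
  have bot_iff : S = ⊥ ↔ r 1 ∉ S ∧ r 2 ∉ S ∧ r 3 ∉ S ∧
      sr 0 ∉ S ∧ sr 1 ∉ S ∧ sr 2 ∉ S ∧ sr 3 ∉ S ∧ sr 4 ∉ S ∧ sr 5 ∉ S := by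
    have ne_one : ∀ g : DihedralGroup 6, g = 1 ↔ g = r 0 := fun _ => Iff.rfl
    simp only [Subgroup.eq_bot_iff_forall, ne_one, forall_mem, r_four, r_five]
    have : (1 : ZMod 6) ≠ 0 ∧ (2 : ZMod 6) ≠ 0 ∧ (3 : ZMod 6) ≠ 0 ∧ (4 : ZMod 6) ≠ 0 ∧
      (5 : ZMod 6) ≠ 0 := by decide
    simp only [r.injEq, reduceCtorEq, this]
    tauto
  have top_iff : S = ⊤ ↔ r 2 ∈ S ∧ r 3 ∈ S ∧ sr 0 ∈ S := by
    refine ⟨by rintro rfl; simp, fun ⟨h₂, h₃, h⟩ => ?_⟩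
    rw [Subgroup.eq_top_iff']
    have h₁ := r_one.2 ⟨h₂, h₃⟩
    have h₄ := r_two 0 h₂ h
    have h₅ := r_two _ h₂ h₄
    exact (forall_mem _).2 ⟨⟨S.one_mem, h₁, h₂, h₃, r_four.2 h₂, r_five.2 h₁⟩,
      h, r_three _ h₃ h₅, h₄, r_three _ h₃ h, h₅, r_three _ h₃ h₄⟩
  rw [bot_iff, top_iff, r_one]
  by_cases h₂ : r 2 ∈ S
  · have e₂ : sr 2 ∈ S ↔ sr 0 ∈ S := ⟨fun h => r_two _ h₂ (r_two _ h₂ h), r_two 0 h₂⟩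
    have e₄ : sr 4 ∈ S ↔ sr 0 ∈ S := ⟨r_two 4 h₂, fun h => r_two _ h₂ (r_two _ h₂ h)⟩
    have e₅ : sr 5 ∈ S ↔ sr 3 ∈ S := ⟨fun h => r_two _ h₂ (r_two _ h₂ h), r_two 3 h₂⟩
    have e₁ : sr 1 ∈ S ↔ sr 3 ∈ S := ⟨r_two 1 h₂, fun h => r_two _ h₂ (r_two _ h₂ h)⟩
    by_cases h₃ : r 3 ∈ S
    · have e₃ : sr 3 ∈ S ↔ sr 0 ∈ S := ⟨r_three 3 h₃, r_three 0 h₃⟩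
      by_cases h : sr 0 ∈ S <;> simp [*]
    · have n₃ : ¬(sr 0 ∈ S ∧ sr 3 ∈ S) := fun h => h₃ (sr_sr _ _ h.1 h.2)
      simp only [h₂, h₃, e₁, e₂, e₄, e₅]
      by_cases h : sr 0 ∈ S <;> by_cases h' : sr 3 ∈ S <;> simp_all
  · have n₀₂ : ¬(sr 0 ∈ S ∧ sr 2 ∈ S) := fun h => h₂ (sr_sr _ _ h.1 h.2)
    have n₂₄ : ¬(sr 2 ∈ S ∧ sr 4 ∈ S) := fun h => h₂ (sr_sr _ _ h.1 h.2)
    have n₄₀ : ¬(sr 4 ∈ S ∧ sr 0 ∈ S) := fun h => h₂ (sr_sr _ _ h.1 h.2)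
    have n₁₃ : ¬(sr 1 ∈ S ∧ sr 3 ∈ S) := fun h => h₂ (sr_sr _ _ h.1 h.2)
    have n₃₅ : ¬(sr 3 ∈ S ∧ sr 5 ∈ S) := fun h => h₂ (sr_sr _ _ h.1 h.2)
    have n₅₁ : ¬(sr 5 ∈ S ∧ sr 1 ∈ S) := fun h => h₂ (sr_sr _ _ h.1 h.2)
    by_cases h₃ : r 3 ∈ S
    · have e₃ : sr 3 ∈ S ↔ sr 0 ∈ S := ⟨r_three 3 h₃, r_three 0 h₃⟩
      have e₅ : sr 5 ∈ S ↔ sr 2 ∈ S := ⟨r_three 5 h₃, r_three 2 h₃⟩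
      have e₁ : sr 1 ∈ S ↔ sr 4 ∈ S := ⟨r_three 1 h₃, r_three 4 h₃⟩
      simp only [h₂, h₃, e₁, e₃, e₅]
      grind
    · have r_neg_one : r 5 ∉ S := fun h => h₂ (r_one.1 (r_five.1 h)).1
      have r_pos_one : r 1 ∉ S := fun h => h₂ (r_one.1 h).1
      have n₀₁ : ¬(sr 0 ∈ S ∧ sr 1 ∈ S) := fun h => r_pos_one (sr_sr _ _ h.1 h.2)
      have n₀₃ : ¬(sr 0 ∈ S ∧ sr 3 ∈ S) := fun h => h₃ (sr_sr _ _ h.1 h.2)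
      have n₀₅ : ¬(sr 0 ∈ S ∧ sr 5 ∈ S) := fun h => r_neg_one (sr_sr _ _ h.1 h.2)
      have n₂₁ : ¬(sr 2 ∈ S ∧ sr 1 ∈ S) := fun h => r_neg_one (sr_sr _ _ h.1 h.2)
      have n₂₃ : ¬(sr 2 ∈ S ∧ sr 3 ∈ S) := fun h => r_pos_one (sr_sr _ _ h.1 h.2)
      have n₂₅ : ¬(sr 2 ∈ S ∧ sr 5 ∈ S) := fun h => h₃ (sr_sr _ _ h.1 h.2)
      have n₄₁ : ¬(sr 4 ∈ S ∧ sr 1 ∈ S) := fun h => h₃ (sr_sr _ _ h.1 h.2)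
      have n₄₃ : ¬(sr 4 ∈ S ∧ sr 3 ∈ S) := fun h => r_neg_one (sr_sr _ _ h.1 h.2)
      have n₄₅ : ¬(sr 4 ∈ S ∧ sr 5 ∈ S) := fun h => r_pos_one (sr_sr _ _ h.1 h.2)
      simp only [h₂, h₃]
      grind

theorem asymmetric_count_dihedral6 (X : Type*) [Fintype X]
    [MulAction (DihedralGroup 6) X] :
    (Nat.card {x : X | MulAction.stabilizer (DihedralGroup 6) x = ⊥} : ℤ) =
      Nat.card X + Nat.card {x : X | (r 1 : DihedralGroup 6) • x = x}
        - Nat.card {x : X | (r 2 : DihedralGroup 6) • x = x}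
        - Nat.card {x : X | (r 3 : DihedralGroup 6) • x = x}
        - 3 * Nat.card {x : X | (sr 0 : DihedralGroup 6) • x = x}
        - 3 * Nat.card {x : X | (sr 3 : DihedralGroup 6) • x = x}
        + 6 * Nat.card {x : X | ∀ h ∈ Subgroup.closure {(r 3 : DihedralGroup 6), sr 0}, h • x = x}
        + 3 * Nat.card {x : X | ∀ h ∈ Subgroup.closure {(r 2 : DihedralGroup 6), sr 0}, h • x = x}
        + 3 * Nat.card {x : X | ∀ h ∈ Subgroup.closure {(r 2 : DihedralGroup 6), sr 3}, h • x = x}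
        - 6 * Nat.card {x : X | ∀ h : DihedralGroup 6, h • x = x} := by
  have card_eq (p : X → Prop) {dec : DecidablePred p} :
      (Nat.card {x : X | p x} : ℤ) = ∑ x, if p x then 1 else 0 := by
    simp [Nat.card_eq_fintype_card, Fintype.card_subtype]
  have card_conj (P : Subgroup (DihedralGroup 6) → Prop) (a : DihedralGroup 6) :
      Nat.card {x : X | P (MulAction.stabilizer (DihedralGroup 6) (a • x))} =
        Nat.card {x : X | P (MulAction.stabilizer (DihedralGroup 6) x)} :=
    Nat.card_congr ((MulAction.toPerm a).subtypeEquiv fun _ => Iff.rfl)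
  have mem_smul (a g : DihedralGroup 6) (x : X) :
      g ∈ MulAction.stabilizer _ (a • x) ↔ a⁻¹ * g * a ∈ MulAction.stabilizer _ x := by
    simp only [MulAction.mem_stabilizer_iff, mul_smul, inv_smul_eq_iff]
  have closure_iff (a b : DihedralGroup 6) (x : X) :
      (∀ h ∈ Subgroup.closure {a, b}, h • x = x) ↔
        a ∈ MulAction.stabilizer _ x ∧ b ∈ MulAction.stabilizer _ x := by
    change Subgroup.closure {a, b} ≤ MulAction.stabilizer _ x ↔ _
    simp [Subgroup.closure_le, Set.insert_subset_iff]
  have top_iff (x : X) : (∀ h : DihedralGroup 6, h • x = x) ↔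
      MulAction.stabilizer (DihedralGroup 6) x = ⊤ := by
    simp [Subgroup.eq_top_iff']
  have card_mem_sr (i j : ZMod 6) (a : DihedralGroup 6) (h : a⁻¹ * sr i * a = sr j) :
      Nat.card {x : X | sr j ∈ MulAction.stabilizer (DihedralGroup 6) x} =
        Nat.card {x : X | sr i ∈ MulAction.stabilizer (DihedralGroup 6) x} := by
    rw [← card_conj (sr i ∈ ·) a]
    simp only [mem_smul, h]
  have card_mem_r_sr (i j : ZMod 6) (a : DihedralGroup 6) (h : a⁻¹ * sr i * a = sr j)
      (h' : a⁻¹ * r 3 * a = r 3) :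
      Nat.card {x : X | r 3 ∈ MulAction.stabilizer (DihedralGroup 6) x ∧
          sr j ∈ MulAction.stabilizer (DihedralGroup 6) x} =
        Nat.card {x : X | r 3 ∈ MulAction.stabilizer (DihedralGroup 6) x ∧
          sr i ∈ MulAction.stabilizer (DihedralGroup 6) x} := by
    rw [← card_conj (fun S => r 3 ∈ S ∧ sr i ∈ S) a]
    simp only [mem_smul, h, h']
  have card_univ : ∑ _x : X, (1 : ℤ) = Nat.card X := by simp
  simp only [closure_iff, top_iff]
  simp only [← MulAction.mem_stabilizer_iff]
  rw [card_eq (dec := fun _ => Classical.propDecidable _)]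
  simp only [DihedralGroup.ite_eq_bot_eq_moebius_sum, Finset.sum_add_distrib,
    Finset.sum_sub_distrib, ← Finset.mul_sum, card_univ, ← card_eq]
  rw [card_mem_sr 0 2 (r 1) (by decide), card_mem_sr 0 4 (r 2) (by decide),
    card_mem_sr 3 5 (r 1) (by decide), card_mem_sr 3 1 (r 2) (by decide),
    card_mem_r_sr 0 2 (r 1) (by decide) (by decide),
    card_mem_r_sr 0 4 (r 2) (by decide) (by decide)]
  ring
end
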